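/- arXiv:2306.17439 — 5 statements merged into one kernel-verified Lean document; each statement's English description precedes it below -/
import Mathlib

section
/- Let V be a finite type, ℓ : V → ℝ, G ⊆ V, and δ ≥ 0. Let p be the softmax of ℓ, i.e., p(v) = exp(ℓ(v))/∑_{w∈V} exp(ℓ(w)), and let p̂ be the softmax of the watermarked logits ℓ̂(v) = ℓ(v) + δ·1(v ∈ G). Then for every subset S ⊆ V, exp(−δ)·∑_{v∈S} p(v) ≤ ∑_{v∈S} p̂(v) ≤ exp(δ)·∑_{v∈S} p(v); equivalently, −δ ≤ log( p̂(S)/p(S) ) ≤ δ for every nonempty S. -/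
open scoped BigOperators

/-- The softmax distribution associated to a vector of logits. -/
noncomputable def softmax {V : Type*} [Fintype V] (l : V → ℝ) (v : V) : ℝ :=
  Real.exp (l v) / ∑ w, Real.exp (l w)

/-- The watermarked logits: add `δ` to the logits of the tokens in the green list `G`. -/
def wmLogits {V : Type*} [DecidableEq V] (l : V → ℝ) (G : Finset V) (δ : ℝ) (v : V) : ℝ :=
  l v + if v ∈ G then δ else 0

theorem softmax_pos {V : Type*} [Fintype V] (l : V → ℝ) (v : V) : 0 < softmax l v :=
  div_pos (Real.exp_pos _)
    (Finset.sum_pos (fun _ _ => Real.exp_pos _) ⟨v, Finset.mem_univ v⟩)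

/-- If passing from `l` to `l'` raises the logit of `v` by at most `a` and lowers no logit by more
than `b`, then the softmax probability of `v` grows by a factor of at most `exp (a + b)`. -/
theorem softmax_le_exp_mul_softmax {V : Type*} [Fintype V] {l l' : V → ℝ} {a b : ℝ} {v : V}
    (ha : l' v ≤ a + l v) (hb : ∀ w, l w ≤ b + l' w) :
    softmax l' v ≤ Real.exp (a + b) * softmax l v := by
  have sum_pos (m : V → ℝ) : 0 < ∑ w, Real.exp (m w) :=
    Finset.sum_pos (fun _ _ => Real.exp_pos _) ⟨v, Finset.mem_univ v⟩
  have num_le : Real.exp (l' v) ≤ Real.exp a * Real.exp (l v) := by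
    rw [← Real.exp_add]
    exact Real.exp_le_exp.2 ha
  have denom_le : ∑ w, Real.exp (l w) ≤ Real.exp b * ∑ w, Real.exp (l' w) := by
    rw [Finset.mul_sum]
    refine Finset.sum_le_sum fun w _ => ?_
    rw [← Real.exp_add]
    exact Real.exp_le_exp.2 (hb w)
  unfold softmax
  rw [← mul_div_assoc, div_le_div_iff₀ (sum_pos l') (sum_pos l), Real.exp_add]
  calc Real.exp (l' v) * ∑ w, Real.exp (l w)
      ≤ (Real.exp a * Real.exp (l v)) * (Real.exp b * ∑ w, Real.exp (l' w)) :=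
        mul_le_mul num_le denom_le (sum_pos l).le (by positivity)
    _ = Real.exp a * Real.exp b * Real.exp (l v) * ∑ w, Real.exp (l' w) := by ring

theorem le_wmLogits {V : Type*} [DecidableEq V] (l : V → ℝ) (G : Finset V) {δ : ℝ} (hδ : 0 ≤ δ)
    (v : V) : l v ≤ wmLogits l G δ v := by
  unfold wmLogits
  split_ifs <;> linarith

theorem wmLogits_le {V : Type*} [DecidableEq V] (l : V → ℝ) (G : Finset V) {δ : ℝ} (hδ : 0 ≤ δ)
    (v : V) : wmLogits l G δ v ≤ δ + l v := by
  unfold wmLogits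
  split_ifs <;> linarith

/-- **(δ,0)-indistinguishability of the watermarked token distribution.**
For every subset `S` of the vocabulary,
`exp(−δ)·p(S) ≤ p̂(S) ≤ exp(δ)·p(S)`; equivalently, for every nonempty `S`,
`−δ ≤ log(p̂(S)/p(S)) ≤ δ`. -/
theorem watermark_max_divergence {V : Type*} [Fintype V] [Nonempty V] [DecidableEq V]
    (l : V → ℝ) (G : Finset V) (δ : ℝ) (hδ : 0 ≤ δ) :
    (∀ S : Finset V,
        Real.exp (-δ) * ∑ v ∈ S, softmax l v ≤ ∑ v ∈ S, softmax (wmLogits l G δ) v ∧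
          ∑ v ∈ S, softmax (wmLogits l G δ) v ≤ Real.exp δ * ∑ v ∈ S, softmax l v) ∧
      (∀ S : Finset V, S.Nonempty →
        -δ ≤ Real.log ((∑ v ∈ S, softmax (wmLogits l G δ) v) / ∑ v ∈ S, softmax l v) ∧
          Real.log ((∑ v ∈ S, softmax (wmLogits l G δ) v) / ∑ v ∈ S, softmax l v) ≤ δ) := by
  have bounds (S : Finset V) :
      Real.exp (-δ) * ∑ v ∈ S, softmax l v ≤ ∑ v ∈ S, softmax (wmLogits l G δ) v ∧
        ∑ v ∈ S, softmax (wmLogits l G δ) v ≤ Real.exp δ * ∑ v ∈ S, softmax l v := by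
    constructor
    · rw [Real.exp_neg, inv_mul_le_iff₀ (Real.exp_pos δ), Finset.mul_sum]
      refine Finset.sum_le_sum fun v _ => ?_
      simpa using softmax_le_exp_mul_softmax (a := 0) (by simpa using le_wmLogits l G hδ v)
        (wmLogits_le l G hδ)
    · rw [Finset.mul_sum]
      refine Finset.sum_le_sum fun v _ => ?_
      simpa using softmax_le_exp_mul_softmax (b := 0) (wmLogits_le l G hδ v)
        (by simpa using le_wmLogits l G hδ)
  refine ⟨bounds, fun S hS => ?_⟩
  have p_pos : 0 < ∑ v ∈ S, softmax l v := Finset.sum_pos (fun v _ => softmax_pos l v) hS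
  have ratio_pos : 0 < (∑ v ∈ S, softmax (wmLogits l G δ) v) / ∑ v ∈ S, softmax l v :=
    div_pos (Finset.sum_pos (fun v _ => softmax_pos _ v) hS) p_pos
  rw [Real.le_log_iff_exp_le ratio_pos, Real.log_le_iff_le_exp ratio_pos, le_div_iff₀ p_pos,
    div_le_iff₀ p_pos]
  exact bounds S
end

section
/- Let V be a finite type, ℓ : V → ℝ, G ⊆ V, and δ ≥ 0. Let p be the softmax of ℓ and p̂ the softmax of the watermarked logits ℓ̂(v) = ℓ(v) + δ·1(v ∈ G). Then both Kullback–Leibler divergences are bounded: ∑_{v∈V} p̂(v)·log( p̂(v)/p(v) ) ≤ min(δ, δ²/8) and ∑_{v∈V} p(v)·log( p(v)/p̂(v) ) ≤ min(δ, δ²/8). -/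
open scoped BigOperators

lemma bernoulli_mgf_pos {q : ℝ} (h0 : 0 ≤ q) (h1 : q ≤ 1) (t : ℝ) :
    0 < 1 - q + q * Real.exp t := by
  rcases h1.lt_or_eq with h | rfl
  · have := mul_nonneg h0 (Real.exp_pos t).le
    linarith
  · simpa using Real.exp_pos t

open MeasureTheory ProbabilityTheory in
/-- Hoeffding's lemma for a Bernoulli variable. -/
lemma log_bernoulli_mgf_le {q : ℝ} (h0 : 0 ≤ q) (h1 : q ≤ 1) (t : ℝ) :
    Real.log (1 - q + q * Real.exp t) ≤ q * t + t ^ 2 / 8 := by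
  let μ : Measure ℝ :=
    ENNReal.ofReal (1 - q) • Measure.dirac 0 + ENNReal.ofReal q • Measure.dirac 1
  have hμ : IsProbabilityMeasure μ := by
    constructor
    simp [μ, ← ENNReal.ofReal_add (sub_nonneg.2 h1) h0]
  have hint (f : ℝ → ℝ) : ∫ x, f x ∂μ = (1 - q) * f 0 + q * f 1 := by
    have h (c : ENNReal) (hc : c ≠ ⊤) (a : ℝ) : Integrable f (c • Measure.dirac a) :=
      (integrable_dirac (by simp)).smul_measure hc
    rw [integral_add_measure (h _ ENNReal.ofReal_ne_top _) (h _ ENNReal.ofReal_ne_top _),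
      integral_smul_measure, integral_smul_measure, integral_dirac, integral_dirac,
      ENNReal.toReal_ofReal (sub_nonneg.2 h1), ENNReal.toReal_ofReal h0, smul_eq_mul, smul_eq_mul]
  have hmem : ∀ᵐ x ∂μ, x ∈ Set.Icc (0 : ℝ) 1 := by
    rw [ae_add_measure_iff]
    exact ⟨Measure.ae_smul_measure (by simp [ae_dirac_eq]) _,
      Measure.ae_smul_measure (by simp [ae_dirac_eq]) _⟩
  have key := (hasSubgaussianMGF_of_mem_Icc (X := fun x : ℝ => x) (by fun_prop) hmem).mgf_le t
  rw [mgf, hint, hint] at key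
  rw [Real.log_le_iff_le_exp (bernoulli_mgf_pos h0 h1 t)]
  have e : 1 - q + q * Real.exp t = Real.exp (q * t) *
      ((1 - q) * Real.exp (t * (0 - ((1 - q) * 0 + q * 1))) +
        q * Real.exp (t * (1 - ((1 - q) * 0 + q * 1)))) := by
    rw [mul_add, mul_left_comm, mul_left_comm _ q, ← Real.exp_add, ← Real.exp_add]
    ring_nf
    simp only [Real.exp_zero]
    ring
  rw [e, Real.exp_add]
  refine mul_le_mul_of_nonneg_left (key.trans_eq ?_) (Real.exp_pos _).le
  congr 1
  simp
  ring

lemma log_bernoulli_mgf_sub_le_abs {q : ℝ} (h0 : 0 ≤ q) (h1 : q ≤ 1) (t : ℝ) :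
    Real.log (1 - q + q * Real.exp t) - q * t ≤ |t| := by
  have hle : 1 - q + q * Real.exp t ≤ Real.exp (max t 0) := by
    have ht : Real.exp t ≤ Real.exp (max t 0) := Real.exp_le_exp.2 (le_max_left _ _)
    have hz : 1 ≤ Real.exp (max t 0) := Real.one_le_exp (le_max_right _ _)
    nlinarith
  have hlog := (Real.log_le_iff_le_exp (bernoulli_mgf_pos h0 h1 t)).2 hle
  rcases le_total 0 t with ht | ht
  · rw [max_eq_left ht] at hlog
    rw [abs_of_nonneg ht]
    nlinarith
  · rw [max_eq_right ht] at hlog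
    rw [abs_of_nonpos ht]
    nlinarith

lemma wmLogits_wmLogits_neg {V : Type*} [DecidableEq V] (l : V → ℝ) (G : Finset V) (t : ℝ) :
    wmLogits (wmLogits l G t) G (-t) = l := by
  ext v
  by_cases hv : v ∈ G <;> simp [wmLogits, hv]

section

variable {V : Type*} [Fintype V]

lemma sum_exp_pos [Nonempty V] (l : V → ℝ) : 0 < ∑ w, Real.exp (l w) :=
  Finset.sum_pos (fun _ _ => Real.exp_pos _) Finset.univ_nonempty

lemma softmax_nonneg (l : V → ℝ) (v : V) : 0 ≤ softmax l v :=
  div_nonneg (Real.exp_pos _).le (Finset.sum_nonneg fun _ _ => (Real.exp_pos _).le)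

lemma sum_softmax [Nonempty V] (l : V → ℝ) : ∑ v, softmax l v = 1 := by
  simp_rw [softmax, ← Finset.sum_div]
  exact div_self (sum_exp_pos l).ne'

variable [DecidableEq V]

lemma sum_exp_wmLogits_div [Nonempty V] (l : V → ℝ) (G : Finset V) (t : ℝ) :
    (∑ w, Real.exp (wmLogits l G t w)) / ∑ w, Real.exp (l w) =
      1 - ∑ v ∈ G, softmax l v + (∑ v ∈ G, softmax l v) * Real.exp t := by
  have h (v : V) : Real.exp (wmLogits l G t v) / ∑ w, Real.exp (l w) =
      softmax l v + if v ∈ G then softmax l v * (Real.exp t - 1) else 0 := by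
    by_cases hv : v ∈ G <;> simp [wmLogits, softmax, hv, Real.exp_add]
    ring
  rw [Finset.sum_div, Finset.sum_congr rfl fun v _ => h v, Finset.sum_add_distrib, sum_softmax,
    Finset.sum_ite_mem, Finset.univ_inter, ← Finset.sum_mul]
  ring

lemma log_softmax_div_softmax_wmLogits [Nonempty V] (l : V → ℝ) (G : Finset V) (t : ℝ) (v : V) :
    Real.log (softmax l v / softmax (wmLogits l G t) v) =
      Real.log ((∑ w, Real.exp (wmLogits l G t w)) / ∑ w, Real.exp (l w)) -
        if v ∈ G then t else 0 := by
  have h₁ := (sum_exp_pos l).ne'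
  have h₂ := (sum_exp_pos (wmLogits l G t)).ne'
  have h₃ := (Real.exp_pos (l v)).ne'
  have h₄ := (Real.exp_pos (wmLogits l G t v)).ne'
  rw [softmax, softmax, Real.log_div (div_ne_zero h₃ h₁) (div_ne_zero h₄ h₂),
    Real.log_div h₃ h₁, Real.log_div h₄ h₂, Real.log_div h₂ h₁, Real.log_exp, Real.log_exp]
  simp only [wmLogits]
  ring

/-- The divergence from a softmax to its shift by any real `t` on `G`. -/
lemma sum_softmax_mul_log_div_wmLogits_le [Nonempty V] (l : V → ℝ) (G : Finset V) (t : ℝ) :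
    ∑ v, softmax l v * Real.log (softmax l v / softmax (wmLogits l G t) v) ≤
      min |t| (t ^ 2 / 8) := by
  have h0 : 0 ≤ ∑ v ∈ G, softmax l v := Finset.sum_nonneg fun v _ => softmax_nonneg l v
  have h1 : ∑ v ∈ G, softmax l v ≤ 1 := (sum_softmax l) ▸
    Finset.sum_le_sum_of_subset_of_nonneg (Finset.subset_univ G) fun v _ _ => softmax_nonneg l v
  simp_rw [log_softmax_div_softmax_wmLogits, sum_exp_wmLogits_div, mul_sub, mul_ite, mul_zero]
  rw [Finset.sum_sub_distrib, ← Finset.sum_mul, sum_softmax, one_mul, Finset.sum_ite_mem,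
    Finset.univ_inter, ← Finset.sum_mul]
  exact le_min (log_bernoulli_mgf_sub_le_abs h0 h1 t)
    (sub_le_iff_le_add'.2 (log_bernoulli_mgf_le h0 h1 t))

end

/-- **KL-divergence bound for the watermarked token distribution.**  Both
Kullback–Leibler divergences between the watermarked softmax distribution `p̂` and the
original softmax distribution `p` are bounded by `min(δ, δ²/8)`. -/
theorem watermark_kl_bound {V : Type*} [Fintype V] [Nonempty V] [DecidableEq V]
    (l : V → ℝ) (G : Finset V) (δ : ℝ) (hδ : 0 ≤ δ) :
    (∑ v, softmax (wmLogits l G δ) v *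
        Real.log (softmax (wmLogits l G δ) v / softmax l v) ≤ min δ (δ ^ 2 / 8)) ∧
      (∑ v, softmax l v *
        Real.log (softmax l v / softmax (wmLogits l G δ) v) ≤ min δ (δ ^ 2 / 8)) := by
  constructor
  · have h := sum_softmax_mul_log_div_wmLogits_le (wmLogits l G δ) G (-δ)
    rwa [wmLogits_wmLogits_neg, abs_neg, abs_of_nonneg hδ, neg_sq] at h
  · simpa only [abs_of_nonneg hδ] using sum_softmax_mul_log_div_wmLogits_le l G δ
end

section
/- Let V be a finite type, ℓ : V → ℝ, G ⊆ V, and δ ≥ 0. Let p be the softmax of ℓ and p̂ the softmax of the watermarked logits ℓ̂(v) = ℓ(v) + δ·1(v ∈ G). Then the total variation distance satisfies (1/2)·∑_{v∈V} | p̂(v) − p(v) | ≤ min( √(δ/2), δ/4 ). -/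
open scoped BigOperators

/-- The normalizing constant of the watermarked softmax, split along the green list. -/
lemma sum_exp_wmLogits {V : Type*} [Fintype V] [DecidableEq V]
    (l : V → ℝ) (G : Finset V) (δ : ℝ) :
    ∑ v, Real.exp (wmLogits l G δ v) =
      Real.exp δ * ∑ v ∈ G, Real.exp (l v) + ∑ v ∈ Gᶜ, Real.exp (l v) := by
  rw [← Finset.sum_add_sum_compl G, Finset.mul_sum]
  congr 1
  · refine Finset.sum_congr rfl fun v hv => ?_
    simp [wmLogits, hv, Real.exp_add, mul_comm]
  · refine Finset.sum_congr rfl fun v hv => ?_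
    simp [wmLogits, Finset.mem_compl.1 hv]

/-- Closed form of the total variation distance between the watermarked and the original
softmax distributions, in terms of the green and non-green masses. -/
lemma half_sum_abs_softmax_wmLogits_sub {V : Type*} [Fintype V] [Nonempty V] [DecidableEq V]
    (l : V → ℝ) (G : Finset V) {δ : ℝ} (hδ : 0 ≤ δ) {A B : ℝ}
    (hA : A = ∑ v ∈ G, Real.exp (l v)) (hB : B = ∑ v ∈ Gᶜ, Real.exp (l v)) :
    (1 / 2) * ∑ v, |softmax (wmLogits l G δ) v - softmax l v| =
      A * B * (Real.exp δ - 1) / ((Real.exp δ * A + B) * (A + B)) := by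
  have hx : 1 ≤ Real.exp δ := Real.one_le_exp hδ
  have hA0 : 0 ≤ A := hA ▸ Finset.sum_nonneg fun v _ => (Real.exp_pos _).le
  have hB0 : 0 ≤ B := hB ▸ Finset.sum_nonneg fun v _ => (Real.exp_pos _).le
  have hS : ∑ v, Real.exp (l v) = A + B := by rw [hA, hB, Finset.sum_add_sum_compl]
  have hpos : 0 < A + B :=
    hS ▸ Finset.sum_pos (fun v _ => Real.exp_pos _) Finset.univ_nonempty
  have hpos' : 0 < Real.exp δ * A + B := by nlinarith
  have hS' : ∑ v, Real.exp (wmLogits l G δ v) = Real.exp δ * A + B := by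
    rw [sum_exp_wmLogits, hA, hB]
  set c := (Real.exp δ - 1) / ((Real.exp δ * A + B) * (A + B)) with hc
  have hc0 : 0 ≤ c := div_nonneg (by linarith) (by positivity)
  have hG : ∀ v ∈ G, |softmax (wmLogits l G δ) v - softmax l v| =
      Real.exp (l v) * (B * c) := by
    intro v hv
    have h : softmax (wmLogits l G δ) v - softmax l v = Real.exp (l v) * (B * c) := by
      rw [softmax, softmax, hS, hS', hc]
      simp only [wmLogits, hv, if_true, Real.exp_add]
      field_simp
      ring
    rw [h, abs_of_nonneg (by positivity)]
  have hGc : ∀ v ∈ Gᶜ, |softmax (wmLogits l G δ) v - softmax l v| =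
      Real.exp (l v) * (A * c) := by
    intro v hv
    have h : softmax (wmLogits l G δ) v - softmax l v = -(Real.exp (l v) * (A * c)) := by
      rw [softmax, softmax, hS, hS', hc]
      simp only [wmLogits, Finset.mem_compl.1 hv, if_false, add_zero]
      field_simp
      ring
    rw [h, abs_neg, abs_of_nonneg (by positivity)]
  rw [← Finset.sum_add_sum_compl G, Finset.sum_congr rfl hG, Finset.sum_congr rfl hGc,
    ← Finset.sum_mul, ← Finset.sum_mul, ← hA, ← hB, mul_div_assoc, ← hc]
  ring

/-- Equality holds when `s * A = B`. -/
lemma mul_mul_sq_sub_one_div_le {A B s : ℝ} (hA : 0 ≤ A) (hAB : 0 < A + B)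
    (hs : 1 ≤ s) :
    A * B * (s ^ 2 - 1) / ((s ^ 2 * A + B) * (A + B)) ≤ (s - 1) / (s + 1) := by
  have hpos : 0 < s ^ 2 * A + B := by
    nlinarith [mul_le_mul_of_nonneg_right (one_le_pow₀ hs (n := 2)) hA]
  rw [div_le_div_iff₀ (mul_pos hpos hAB) (by linarith)]
  have h := mul_nonneg (sub_nonneg.2 hs) (sq_nonneg (s * A - B))
  linear_combination h

/-- **Total variation bound for the watermarked token distribution.**  The total
variation distance between the watermarked softmax distribution `p̂` and the original
softmax distribution `p` is at most `min(√(δ/2), δ/4)`. -/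
theorem watermark_tv_bound {V : Type*} [Fintype V] [Nonempty V] [DecidableEq V]
    (l : V → ℝ) (G : Finset V) (δ : ℝ) (hδ : 0 ≤ δ) :
    (1 / 2) * ∑ v, |softmax (wmLogits l G δ) v - softmax l v| ≤
      min (Real.sqrt (δ / 2)) (δ / 4) := by
  set s := Real.exp (δ / 2) with hs
  have hs1 : 1 ≤ s := Real.one_le_exp (by linarith)
  have hsq : Real.exp δ = s ^ 2 := by
    rw [hs, ← Real.exp_nat_mul]
    congr 1
    push_cast
    ring
  have hpos : 0 < ∑ v ∈ G, Real.exp (l v) + ∑ v ∈ Gᶜ, Real.exp (l v) := by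
    rw [Finset.sum_add_sum_compl]
    exact Finset.sum_pos (fun v _ => Real.exp_pos _) Finset.univ_nonempty
  have key : (1 / 2) * ∑ v, |softmax (wmLogits l G δ) v - softmax l v| ≤
      (s - 1) / (s + 1) := by
    rw [half_sum_abs_softmax_wmLogits_sub l G hδ rfl rfl, hsq]
    exact mul_mul_sq_sub_one_div_le (Finset.sum_nonneg fun v _ => (Real.exp_pos _).le)
      hpos hs1
  have h_one : (s - 1) / (s + 1) ≤ 1 := by
    rw [div_le_one (by linarith)]
    linarith
  have h_lin : (s - 1) / (s + 1) ≤ δ / 4 := by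
    have h := Real.le_log_one_add_of_nonneg (sub_nonneg.2 hs1)
    rw [add_sub_cancel, hs, Real.log_exp, ← hs, show s - 1 + 2 = s + 1 by ring,
      mul_div_assoc] at h
    linarith
  refine key.trans (le_min (Real.le_sqrt_of_sq_le ?_) h_lin)
  have h_nonneg : 0 ≤ (s - 1) / (s + 1) := div_nonneg (by linarith) (by linarith)
  nlinarith
end

section
/- Let V be a finite type with N elements, k a natural number with 1 ≤ k ≤ N, γ = k/N, and y = [y_1,…,y_n] a fixed sequence over V with n ≥ 1. For each token i ∈ V let c_i = #{t : y_t = i}, and set C_max = max_i c_i and Var = (1/n)·∑_{i∈V} c_i². Then for every α ∈ (0,1], the number of size-k subsets G ⊆ V such that |y|_G ≥ γn + √(64·γ·n·Var·log(9/α)) + C_max·log(9/α) is at most α·C(N,k). -/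
open scoped BigOperators

/-- Number of tokens of the sequence `y` that fall in the green list `G`. -/
def greenCount {V : Type*} [DecidableEq V] (G : Finset V) (y : List V) : ℕ :=
  (y.filter (fun v => v ∈ G)).length

lemma greenCount_eq_sum_count {V : Type*} [DecidableEq V] (G : Finset V) (y : List V) :
    greenCount G y = ∑ i ∈ G, y.count i := by
  induction y with
  | nil => simp [greenCount]
  | cons a l ih =>
    have h : greenCount G (a :: l) = greenCount G l + if a ∈ G then 1 else 0 := by
      unfold greenCount
      split_ifs with h <;> simp [h]
    rw [h, ih]
    simp [List.count_cons, Finset.sum_add_distrib]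

lemma descFactorial_mul_pow_le {k N : ℕ} (h : k ≤ N) (s : ℕ) :
    k.descFactorial s * N ^ s ≤ k ^ s * N.descFactorial s := by
  induction s with
  | zero => simp
  | succ s ih =>
    have h1 : (k - s) * N ≤ k * (N - s) := by
      rw [Nat.sub_mul, Nat.mul_sub]
      have : k * s ≤ s * N := by rw [mul_comm]; exact Nat.mul_le_mul_left s h
      omega
    rw [Nat.descFactorial_succ, Nat.descFactorial_succ]
    calc (k - s) * k.descFactorial s * N ^ (s + 1)
        = ((k - s) * N) * (k.descFactorial s * N ^ s) := by ring
      _ ≤ (k * (N - s)) * (k ^ s * N.descFactorial s) := Nat.mul_le_mul h1 ih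
      _ = k ^ (s + 1) * ((N - s) * N.descFactorial s) := by ring

/-- The fraction of `k`-subsets of an `N`-set that contain a fixed `s`-set is at most
`(k / N) ^ s`. -/
lemma card_powersetCard_superset_le {V : Type*} [Fintype V] [DecidableEq V] {k : ℕ}
    (hk1 : 1 ≤ k) (hk2 : k ≤ Fintype.card V) (S : Finset V) :
    (((Finset.powersetCard k (Finset.univ : Finset V)).filter (fun G => S ⊆ G)).card : ℝ) ≤
      ((Fintype.card V).choose k : ℝ) * ((k : ℝ) / (Fintype.card V : ℝ)) ^ S.card := by
  set N := Fintype.card V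
  by_cases hs : S.card ≤ k
  · have hcard : ((Finset.powersetCard k (Finset.univ : Finset V)).filter
        (fun G => S ⊆ G)).card ≤ (N - S.card).choose (k - S.card) := by
      have hc : (Finset.powersetCard (k - S.card) Sᶜ).card
          = (N - S.card).choose (k - S.card) := by
        rw [Finset.card_powersetCard, Finset.card_compl]
      rw [← hc]
      refine Finset.card_le_card_of_injOn (fun G => G \ S) ?_ ?_
      · intro G hG
        simp only [Finset.coe_filter, Finset.mem_powersetCard, Set.mem_ofPred_eq] at hG
        simp only [Finset.mem_coe, Finset.mem_powersetCard]
        refine ⟨fun x hx => ?_, ?_⟩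
        · simp only [Finset.mem_sdiff] at hx
          simpa using hx.2
        · rw [Finset.card_sdiff_of_subset hG.2, hG.1.2]
      · intro G hG H hH hGH
        simp only [Finset.coe_filter, Set.mem_ofPred_eq] at hG hH
        simp only at hGH
        rw [← Finset.sdiff_union_of_subset hG.2, hGH, Finset.sdiff_union_of_subset hH.2]
    refine (Nat.cast_le.mpr hcard).trans ?_
    have hNpos : (0 : ℝ) < (N : ℝ) ^ S.card := by
      have : (0 : ℝ) < N := by exact_mod_cast lt_of_lt_of_le hk1 hk2
      positivity
    rw [div_pow, ← mul_div_assoc, le_div_iff₀ hNpos]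
    have hD : 0 < N.descFactorial S.card := Nat.pos_of_ne_zero fun h => by
      rw [Nat.descFactorial_eq_zero_iff_lt] at h
      omega
    have e1 := Nat.choose_mul (n := N) hs
    have e2 : N.choose k * k.descFactorial S.card
        = N.descFactorial S.card * (N - S.card).choose (k - S.card) := by
      rw [Nat.descFactorial_eq_factorial_mul_choose, Nat.descFactorial_eq_factorial_mul_choose]
      linear_combination S.card.factorial * e1
    have e3 := descFactorial_mul_pow_le hk2 S.card
    have e4 : (N - S.card).choose (k - S.card) * N ^ S.card ≤ N.choose k * k ^ S.card := by
      refine Nat.le_of_mul_le_mul_left ?_ hD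
      calc N.descFactorial S.card * ((N - S.card).choose (k - S.card) * N ^ S.card)
          = N.choose k * (k.descFactorial S.card * N ^ S.card) := by
            rw [← mul_assoc, ← e2, mul_assoc]
        _ ≤ N.choose k * (k ^ S.card * N.descFactorial S.card) := Nat.mul_le_mul_left _ e3
        _ = N.descFactorial S.card * (N.choose k * k ^ S.card) := by ring
    exact_mod_cast e4
  · rw [Finset.filter_false_of_mem]
    · simp only [Finset.card_empty, Nat.cast_zero]
      positivity
    · intro G hG hSG
      have := Finset.card_le_card hSG
      rw [(Finset.mem_powersetCard.mp hG).2] at this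
      exact hs this

/-- Products over a uniformly random `k`-subset are dominated in expectation by products over
an independent Bernoulli sample with the same inclusion probability. -/
lemma sum_powersetCard_prod_one_add_le {V : Type*} [Fintype V] [DecidableEq V] {k : ℕ}
    (hk1 : 1 ≤ k) (hk2 : k ≤ Fintype.card V) (z : V → ℝ) (hz : ∀ i, 0 ≤ z i) :
    ∑ G ∈ Finset.powersetCard k (Finset.univ : Finset V), ∏ i ∈ G, (1 + z i) ≤
      ((Fintype.card V).choose k : ℝ) *
        ∏ i, (1 + (k : ℝ) / (Fintype.card V : ℝ) * z i) := by
  calc ∑ G ∈ Finset.powersetCard k (Finset.univ : Finset V), ∏ i ∈ G, (1 + z i)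
      = ∑ G ∈ Finset.powersetCard k (Finset.univ : Finset V),
          ∑ S : Finset V, if S ⊆ G then ∏ i ∈ S, z i else 0 := by
        refine Finset.sum_congr rfl fun G _ => ?_
        rw [Finset.prod_one_add, ← Finset.sum_filter]
        refine Finset.sum_congr ?_ fun _ _ => rfl
        ext S
        simp
    _ = ∑ S : Finset V, (((Finset.powersetCard k (Finset.univ : Finset V)).filter
          (fun G => S ⊆ G)).card : ℝ) * ∏ i ∈ S, z i := by
        rw [Finset.sum_comm]
        refine Finset.sum_congr rfl fun S _ => ?_
        rw [← Finset.sum_filter, Finset.sum_const, nsmul_eq_mul]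
    _ ≤ ∑ S : Finset V, (((Fintype.card V).choose k : ℝ) *
          ((k : ℝ) / (Fintype.card V : ℝ)) ^ S.card) * ∏ i ∈ S, z i := by
        refine Finset.sum_le_sum fun S _ => ?_
        exact mul_le_mul_of_nonneg_right (card_powersetCard_superset_le hk1 hk2 S)
          (Finset.prod_nonneg fun i _ => hz i)
    _ = _ := by
        rw [Finset.prod_one_add, Finset.mul_sum, Finset.powerset_univ]
        refine Finset.sum_congr rfl fun S _ => ?_
        rw [Finset.prod_mul_distrib, Finset.prod_const, mul_assoc]

/-- Moment generating function bound for a weighted sum over a uniformly random `k`-subset. -/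
lemma sum_powersetCard_exp_le {V : Type*} [Fintype V] [DecidableEq V] {k : ℕ}
    (hk1 : 1 ≤ k) (hk2 : k ≤ Fintype.card V) (a : V → ℝ) (ha0 : ∀ i, 0 ≤ a i)
    (ha1 : ∀ i, a i ≤ 1) :
    ∑ G ∈ Finset.powersetCard k (Finset.univ : Finset V), Real.exp (∑ i ∈ G, a i) ≤
      ((Fintype.card V).choose k : ℝ) *
        Real.exp ((k : ℝ) / (Fintype.card V : ℝ) * (∑ i, a i + ∑ i, a i ^ 2)) := by
  have h := sum_powersetCard_prod_one_add_le hk1 hk2 (fun i => Real.exp (a i) - 1)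
    (fun i => by linarith [Real.add_one_le_exp (a i), ha0 i])
  simp only [add_sub_cancel] at h
  simp only [Real.exp_sum]
  refine h.trans (mul_le_mul_of_nonneg_left ?_ (by positivity))
  rw [← Finset.sum_add_distrib, Finset.mul_sum, Real.exp_sum]
  have hγ : (0 : ℝ) ≤ (k : ℝ) / (Fintype.card V : ℝ) := by positivity
  refine Finset.prod_le_prod (fun i _ => ?_) fun i _ => ?_
  · have : 0 ≤ Real.exp (a i) - 1 := by linarith [Real.add_one_le_exp (a i), ha0 i]
    positivity
  · have h1 : Real.exp (a i) - 1 ≤ a i + a i ^ 2 := by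
      have := Real.abs_exp_sub_one_sub_id_le (x := a i) (by rw [abs_of_nonneg (ha0 i)]; exact ha1 i)
      linarith [le_abs_self (Real.exp (a i) - 1 - a i)]
    have h2 := mul_le_mul_of_nonneg_left h1 hγ
    linarith [Real.add_one_le_exp ((k : ℝ) / (Fintype.card V : ℝ) * (a i + a i ^ 2))]

/-- Existence of a good Chernoff parameter for a Bernstein-type tail. -/
lemma exists_chernoff_parameter {v L C : ℝ} (hv : 0 < v) (hL : 0 < L) (hC : 0 < C) :
    ∃ l : ℝ, 0 < l ∧ l * C ≤ 1 ∧
      l ^ 2 * v - l * (Real.sqrt (64 * v * L) + C * L) ≤ -L := by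
  have hsq : Real.sqrt (64 * v * L) = 8 * (Real.sqrt v * Real.sqrt L) := by
    rw [mul_assoc, Real.sqrt_mul (by norm_num), Real.sqrt_mul hv.le,
      show (64 : ℝ) = 8 ^ 2 by norm_num, Real.sqrt_sq (by norm_num)]
  rw [hsq]
  have hp : 0 < Real.sqrt v := Real.sqrt_pos.mpr hv
  have hq : 0 < Real.sqrt L := Real.sqrt_pos.mpr hL
  have hpv := Real.sq_sqrt hv.le
  have hqL := Real.sq_sqrt hL.le
  set p := Real.sqrt v
  set q := Real.sqrt L
  rw [← hpv, ← hqL]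
  by_cases h : q / p * C ≤ 1
  · refine ⟨q / p, by positivity, h, ?_⟩
    have e : (q / p) ^ 2 * p ^ 2 - q / p * (8 * (p * q) + C * q ^ 2)
        = q ^ 2 - 8 * q ^ 2 - q / p * C * q ^ 2 := by
      field_simp
      ring
    rw [e]
    have : 0 ≤ q / p * C * q ^ 2 := by positivity
    nlinarith [sq_nonneg q]
  · refine ⟨1 / C, by positivity, (by field_simp; exact le_rfl), ?_⟩
    have h' : p ≤ q * C := by
      rw [not_le, div_mul_eq_mul_div, lt_div_iff₀ hp] at h
      linarith
    have e : (1 / C) ^ 2 * p ^ 2 - 1 / C * (8 * (p * q) + C * q ^ 2)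
        = (p * (p - 8 * (q * C))) / C ^ 2 - q ^ 2 := by
      field_simp
      ring
    rw [e]
    have : (p * (p - 8 * (q * C))) / C ^ 2 ≤ 0 := by
      refine div_nonpos_of_nonpos_of_nonneg ?_ (by positivity)
      have : 0 < q * C := by positivity
      exact mul_nonpos_of_nonneg_of_nonpos hp.le (by linarith)
    linarith

open Classical in
/-- **High-probability no-false-positive (Type I error) guarantee.**  Fix a sequence `y`
of length `n ≥ 1` with token counts `c_i`, maximum multiplicity `C_max` and diversity
parameter `Var = (1/n)∑_i c_i²`.  For every `α ∈ (0,1]`, the fraction of size-`k`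
green lists `G` for which
`|y|_G ≥ γn + √(64 γ n Var log(9/α)) + C_max log(9/α)` is at most `α`. -/
theorem no_false_positive {V : Type*} [Fintype V] [DecidableEq V]
    (N k : ℕ) (hN : N = Fintype.card V) (hk1 : 1 ≤ k) (hk2 : k ≤ N)
    (γ : ℝ) (hγ : γ = (k : ℝ) / (N : ℝ))
    (y : List V) (n : ℕ) (hn : n = y.length) (hn1 : 1 ≤ n)
    (Cmax : ℕ) (hCmax : Cmax = (Finset.univ : Finset V).sup (fun i => y.count i))
    (Var : ℝ) (hVar : Var = (1 / (n : ℝ)) * ∑ i : V, ((y.count i : ℝ)) ^ 2)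
    (α : ℝ) (hα : α ∈ Set.Ioc (0 : ℝ) 1) :
    (((Finset.powersetCard k (Finset.univ : Finset V)).filter
        (fun G =>
          (greenCount G y : ℝ) ≥
            γ * (n : ℝ) + Real.sqrt (64 * γ * (n : ℝ) * Var * Real.log (9 / α)) +
              (Cmax : ℝ) * Real.log (9 / α))).card : ℝ) ≤
      α * (N.choose k : ℝ) := by
  obtain ⟨hα0, hα1⟩ := hα
  subst hN
  have hcount : ∑ i : V, (y.count i : ℝ) = n := by
    have h := greenCount_eq_sum_count (Finset.univ : Finset V) y
    rw [hn]
    simp only [greenCount, Finset.mem_univ, decide_true, List.filter_true] at h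
    exact_mod_cast h.symm
  have hle : ∀ i, y.count i ≤ Cmax := fun i => by
    rw [hCmax]
    exact Finset.le_sup (f := fun i => y.count i) (Finset.mem_univ i)
  have hnpos : (0 : ℝ) < n := by exact_mod_cast hn1
  obtain ⟨i₀, hi₀⟩ : ∃ i, 0 < y.count i := by
    obtain ⟨a, ha⟩ := List.exists_mem_of_length_pos (hn ▸ hn1 : 0 < y.length)
    exact ⟨a, List.count_pos_iff.mpr ha⟩
  have hC : (0 : ℝ) < Cmax := by exact_mod_cast hi₀.trans_le (hle i₀)
  have hsq : 0 < ∑ i : V, (y.count i : ℝ) ^ 2 :=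
    Finset.sum_pos' (fun i _ => by positivity)
      ⟨i₀, Finset.mem_univ _, by have : (0 : ℝ) < y.count i₀ := by exact_mod_cast hi₀
                                 positivity⟩
  have hγpos : 0 < γ := by
    have h1 : (0 : ℝ) < k := by exact_mod_cast hk1
    have h2 : (0 : ℝ) < Fintype.card V := by exact_mod_cast hk1.trans hk2
    rw [hγ]
    positivity
  have hnVar : n * Var = ∑ i : V, (y.count i : ℝ) ^ 2 := by
    rw [hVar]
    field_simp
  have hv : 0 < γ * (∑ i : V, (y.count i : ℝ) ^ 2) := by positivity
  have hlog : Real.log (9 / α) = Real.log 9 - Real.log α :=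
    Real.log_div (by norm_num) hα0.ne'
  have hlog9 : 0 < Real.log 9 := Real.log_pos (by norm_num)
  have hL : 0 < Real.log (9 / α) := by linarith [Real.log_nonpos hα0.le hα1]
  obtain ⟨l, hl, hlC, hl3⟩ := exists_chernoff_parameter hv hL hC
  rw [show 64 * γ * (n : ℝ) * Var * Real.log (9 / α)
    = 64 * (γ * (∑ i : V, (y.count i : ℝ) ^ 2)) * Real.log (9 / α) by rw [← hnVar]; ring]
  set L := Real.log (9 / α)
  set Q := ∑ i : V, (y.count i : ℝ) ^ 2
  set R := Real.sqrt (64 * (γ * Q) * L)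
  set T := γ * (n : ℝ) + R + Cmax * L with hT
  have hmgf := sum_powersetCard_exp_le hk1 hk2 (fun i => l * (y.count i : ℝ))
    (fun i => by positivity)
    (fun i => (mul_le_mul_of_nonneg_left (Nat.cast_le.mpr (hle i)) hl.le).trans hlC)
  rw [← hγ] at hmgf
  simp only [mul_pow, ← Finset.mul_sum] at hmgf
  rw [hcount] at hmgf
  set F := (Finset.powersetCard k (Finset.univ : Finset V)).filter
    (fun G => (greenCount G y : ℝ) ≥ T)
  have hmarkov : (F.card : ℝ) * Real.exp (l * T) ≤
      ((Fintype.card V).choose k : ℝ) * Real.exp (γ * (l * n + l ^ 2 * Q)) := by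
    refine le_trans ?_ hmgf
    rw [← nsmul_eq_mul, ← Finset.sum_const]
    refine le_trans (Finset.sum_le_sum fun G hG => ?_)
      (Finset.sum_le_sum_of_subset_of_nonneg (Finset.filter_subset _ _)
        fun _ _ _ => (Real.exp_pos _).le)
    have h := (Finset.mem_filter.mp hG).2
    rw [greenCount_eq_sum_count, Nat.cast_sum] at h
    exact Real.exp_le_exp.mpr (mul_le_mul_of_nonneg_left h hl.le)
  have hexp : Real.exp (γ * (l * n + l ^ 2 * Q)) ≤ α * Real.exp (l * T) := by
    rw [← Real.exp_log hα0, ← Real.exp_add]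
    refine Real.exp_le_exp.mpr ?_
    rw [hT]
    linarith
  refine le_of_mul_le_mul_right ?_ (Real.exp_pos (l * T))
  calc (F.card : ℝ) * Real.exp (l * T)
      ≤ ((Fintype.card V).choose k : ℝ) * Real.exp (γ * (l * n + l ^ 2 * Q)) := hmarkov
    _ ≤ ((Fintype.card V).choose k : ℝ) * (α * Real.exp (l * T)) :=
        mul_le_mul_of_nonneg_left hexp (by positivity)
    _ = α * ((Fintype.card V).choose k : ℝ) * Real.exp (l * T) := by ring
end

section
/- Let V be a finite type with N elements, let p : V → ℝ be a probability vector (p(v) ≥ 0 and ∑_v p(v) = 1), let k be a natural number with 1 ≤ k ≤ N, and set γ = k/N. Then the average over all size-k subsets G ⊆ V of (p(G) − γ)² is at most γ·(1−γ)·∑_{v∈V} p(v)²; that is, (1/C(N,k))·∑_{G ⊆ V, |G| = k} ( ∑_{v∈G} p(v) − γ )² ≤ γ·(1−γ)·∑_{v∈V} p(v)². -/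
open scoped BigOperators

open Finset in
/-- Double counting of the pairs `s ⊆ G` with `#s = j` and `#G = k`. -/
theorem card_filter_subset_powersetCard_mul_choose {V : Type*} [Fintype V] [DecidableEq V]
    (s : Finset V) (k : ℕ) :
    #{G ∈ powersetCard k (univ : Finset V) | s ⊆ G} * (Fintype.card V).choose #s =
      (Fintype.card V).choose k * k.choose #s := by
  by_cases hs : #s ≤ k
  · rw [card_filter_powersetCard_subset s univ k (subset_univ s) hs, card_univ,
      Nat.choose_mul hs, mul_comm]
  · have hempty : {G ∈ powersetCard k (univ : Finset V) | s ⊆ G} = ∅ := by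
      refine filter_eq_empty_iff.2 fun G hG hsG => hs ?_
      rw [← (mem_powersetCard.1 hG).2]
      exact card_le_card hsG
    rw [hempty, card_empty, zero_mul, Nat.choose_eq_zero_of_lt (not_le.1 hs), mul_zero]

open Finset in
/-- A given element lies in a uniform `k`-subset with probability `k / N`. -/
theorem card_filter_mem_powersetCard {V : Type*} [Fintype V] [DecidableEq V]
    (k : ℕ) (v : V) :
    (#{G ∈ powersetCard k (univ : Finset V) | v ∈ G} : ℝ) =
      (Fintype.card V).choose k * (k / Fintype.card V : ℝ) := by
  have h := card_filter_subset_powersetCard_mul_choose {v} k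
  simp only [singleton_subset_iff, card_singleton, Nat.choose_one_right] at h
  have hN : (0 : ℝ) < Fintype.card V := by exact_mod_cast Fintype.card_pos_iff.2 ⟨v⟩
  rw [← mul_div_assoc, eq_div_iff hN.ne']
  exact_mod_cast h

open Finset in
/-- Two distinct elements are negatively correlated in a uniform `k`-subset. -/
theorem card_filter_mem_mem_powersetCard_le {V : Type*} [Fintype V] [DecidableEq V]
    (k : ℕ) (hk : k ≤ Fintype.card V) {v w : V} (hvw : v ≠ w) :
    (#{G ∈ powersetCard k (univ : Finset V) | v ∈ G ∧ w ∈ G} : ℝ) ≤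
      (Fintype.card V).choose k * (k / Fintype.card V : ℝ) ^ 2 := by
  have h := card_filter_subset_powersetCard_mul_choose {v, w} k
  simp only [insert_subset_iff, singleton_subset_iff, card_pair hvw] at h
  have hN : 2 ≤ Fintype.card V := by
    simpa [card_pair hvw] using card_le_univ ({v, w} : Finset V)
  have h' := congrArg (Nat.cast (R := ℝ)) h
  push_cast [Nat.cast_choose_two] at h'
  have hN' : (2 : ℝ) ≤ Fintype.card V := by exact_mod_cast hN
  have hk' : (k : ℝ) ≤ Fintype.card V := by exact_mod_cast hk
  set N : ℝ := (Fintype.card V : ℝ)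
  set C : ℝ := ((Fintype.card V).choose k : ℝ)
  have hC : 0 ≤ C := Nat.cast_nonneg _
  have hpos : 0 < N * (N - 1) := mul_pos (by linarith) (by linarith)
  have hcmp : (k : ℝ) * (k - 1) ≤ (k / N) ^ 2 * (N * (N - 1)) := by
    have hE : (k / N : ℝ) ^ 2 * (N * (N - 1)) = k * (k - 1) + k * (N - k) / N := by
      field_simp
      ring
    rw [hE]
    have : 0 ≤ (k : ℝ) * (N - k) / N :=
      div_nonneg (mul_nonneg (Nat.cast_nonneg _) (by linarith)) (by linarith)
    linarith
  refine le_of_mul_le_mul_right ?_ hpos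
  have := mul_le_mul_of_nonneg_left hcmp hC
  linarith

open Finset in
/-- The second moment of a subset sum, expanded into pair inclusion counts. -/
theorem sum_sq_sum_eq_sum_card_filter {V : Type*} [Fintype V] [DecidableEq V]
    (p : V → ℝ) (F : Finset (Finset V)) :
    ∑ G ∈ F, (∑ v ∈ G, p v) ^ 2 =
      ∑ v, ∑ w, (#{G ∈ F | v ∈ G ∧ w ∈ G} : ℝ) * (p v * p w) := by
  have h (G : Finset V) : (∑ v ∈ G, p v) ^ 2 =
      ∑ v, ∑ w, if v ∈ G ∧ w ∈ G then p v * p w else 0 := by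
    rw [sq, sum_mul_sum]
    simp [ite_and, sum_ite_mem, sum_ite_irrel]
  simp_rw [h]
  rw [sum_comm]
  refine sum_congr rfl fun v _ => ?_
  rw [sum_comm]
  refine sum_congr rfl fun w _ => ?_
  rw [← sum_filter, sum_const, nsmul_eq_mul]

open Finset in
/-- The first moment of a subset sum, expanded into inclusion counts. -/
theorem sum_sum_eq_sum_card_filter {V : Type*} [Fintype V] [DecidableEq V]
    (p : V → ℝ) (F : Finset (Finset V)) :
    ∑ G ∈ F, ∑ v ∈ G, p v = ∑ v, (#{G ∈ F | v ∈ G} : ℝ) * p v := by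
  have h (G : Finset V) : ∑ v ∈ G, p v = ∑ v, if v ∈ G then p v else 0 := by
    simp [sum_ite_mem]
  simp_rw [h]
  rw [sum_comm]
  refine sum_congr rfl fun v _ => ?_
  rw [← sum_filter, sum_const, nsmul_eq_mul]

/-- **Variance bound for sampling without replacement.**  For a probability vector `p`
on a vocabulary of `N` tokens and a green list `G` drawn uniformly among all size-`k`
subsets (`γ = k/N`), the average of `(p(G) − γ)²` is at most `γ(1−γ)·∑_v p(v)²`. -/
theorem green_probability_variance_bound {V : Type*} [Fintype V]
    (p : V → ℝ) (hp0 : ∀ v, 0 ≤ p v) (hp1 : ∑ v, p v = 1)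
    (k : ℕ) (hk1 : 1 ≤ k) (hk2 : k ≤ Fintype.card V)
    (γ : ℝ) (hγ : γ = (k : ℝ) / (Fintype.card V : ℝ)) :
    (1 / ((Fintype.card V).choose k : ℝ)) *
        ∑ G ∈ Finset.powersetCard k (Finset.univ : Finset V),
          ((∑ v ∈ G, p v) - γ) ^ 2 ≤
      γ * (1 - γ) * ∑ v, p v ^ 2 := by
  classical
  set C : ℝ := ((Fintype.card V).choose k : ℝ) with hC
  have hCpos : 0 < C := Nat.cast_pos.2 (Nat.choose_pos hk2)
  have hfirst : ∑ G ∈ Finset.powersetCard k (Finset.univ : Finset V), ∑ v ∈ G, p v = C * γ := by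
    simp_rw [sum_sum_eq_sum_card_filter, card_filter_mem_powersetCard k, ← hγ]
    rw [← Finset.mul_sum, hp1, mul_one]
  have hpair (v w : V) :
      (Finset.card {G ∈ Finset.powersetCard k (Finset.univ : Finset V) | v ∈ G ∧ w ∈ G} : ℝ) *
        (p v * p w) ≤
      C * γ ^ 2 * (p v * p w) + if v = w then C * (γ - γ ^ 2) * (p v * p w) else 0 := by
    split_ifs with hvw
    · subst hvw
      simp only [and_self, card_filter_mem_powersetCard k, ← hγ, ← hC]
      exact le_of_eq (by ring)
    · rw [add_zero, hγ]
      exact mul_le_mul_of_nonneg_right (card_filter_mem_mem_powersetCard_le k hk2 hvw)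
        (mul_nonneg (hp0 v) (hp0 w))
  have hsecond : ∑ G ∈ Finset.powersetCard k (Finset.univ : Finset V), (∑ v ∈ G, p v) ^ 2 ≤
      C * γ ^ 2 + C * (γ - γ ^ 2) * ∑ v, p v ^ 2 := by
    rw [sum_sq_sum_eq_sum_card_filter]
    refine (Finset.sum_le_sum fun v _ => Finset.sum_le_sum fun w _ => hpair v w).trans_eq ?_
    simp only [Finset.sum_add_distrib, Finset.sum_ite_eq, Finset.mem_univ, if_true,
      ← Finset.mul_sum, hp1, mul_one, sq (p _)]
  have hexpand : ∑ G ∈ Finset.powersetCard k (Finset.univ : Finset V), ((∑ v ∈ G, p v) - γ) ^ 2 =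
      ∑ G ∈ Finset.powersetCard k (Finset.univ : Finset V), (∑ v ∈ G, p v) ^ 2 - C * γ ^ 2 := by
    simp_rw [sub_sq, Finset.sum_add_distrib, Finset.sum_sub_distrib, mul_assoc, ← Finset.mul_sum,
      ← Finset.sum_mul, hfirst, Finset.sum_const, Finset.card_powersetCard, Finset.card_univ,
      nsmul_eq_mul]
    ring
  rw [one_div, inv_mul_le_iff₀ hCpos, hexpand]
  linarith
end
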